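/- Fix real κ, ρ, t with t > 0 and u ∈ ℂ with u ≠ 0. For σ ∈ ℝ, σ ≠ 0, define ξ(σ) := κ − σρiu, d(σ) := (ξ(σ)² + σ²(u²+iu))^{1/2} (principal square root), A₁(σ) := (u²+iu)·sinh(d(σ)t/2), and A₂(σ) := d(σ)·cosh(d(σ)t/2) + ξ(σ)·sinh(d(σ)t/2). Suppose at σ₀ ≠ 0 the radicand ξ(σ₀)² + σ₀²(u²+iu) does not lie in (−∞, 0] and ξ(σ₀) ≠ 0. Then σ ↦ A₂(σ) is differentiable at σ₀ with derivative ∂A₂/∂σ = (ρ/σ₀)·A₂ρ' − ((2 + tξ(σ₀))/(iutξ(σ₀)))·A₁ρ' + σ₀·t·A₁(σ₀)/2, where A₂ρ' := −σ₀ iu(2+tξ(σ₀))(ξ(σ₀) cosh(d(σ₀)t/2) + d(σ₀) sinh(d(σ₀)t/2))/(2d(σ₀)) and A₁ρ' := −iu(u²+iu)tξ(σ₀)σ₀ cosh(d(σ₀)t/2)/(2d(σ₀)) are the corresponding ρ-partial derivative expressions. -/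

import Mathlib

noncomputable section

/-- Principal complex square root `z^{1/2} := exp((1/2)·Log z)`. -/
def csqrt (z : ℂ) : ℂ := Complex.exp ((1 / 2 : ℂ) * Complex.log z)

/-- `ξ(σ) := κ − σρiu`. -/
def ξf (κ ρ : ℝ) (u : ℂ) (σ : ℝ) : ℂ := (κ : ℂ) - (σ : ℂ) * (ρ : ℂ) * Complex.I * u

/-- `d(σ) := (ξ(σ)² + σ²(u²+iu))^{1/2}` (principal square root). -/
def df (κ ρ : ℝ) (u : ℂ) (σ : ℝ) : ℂ :=
  csqrt ((ξf κ ρ u σ) ^ 2 + (σ : ℂ) ^ 2 * (u ^ 2 + Complex.I * u))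

/-- `A₁(σ) := (u²+iu)·sinh(d(σ)t/2)`. -/
def A₁f (κ ρ t : ℝ) (u : ℂ) (σ : ℝ) : ℂ :=
  (u ^ 2 + Complex.I * u) * Complex.sinh (df κ ρ u σ * (t : ℂ) / 2)

/-- `A₂(σ) := d(σ)·cosh(d(σ)t/2) + ξ(σ)·sinh(d(σ)t/2)`. -/
def A₂f (κ ρ t : ℝ) (u : ℂ) (σ : ℝ) : ℂ :=
  df κ ρ u σ * Complex.cosh (df κ ρ u σ * (t : ℂ) / 2) +
    ξf κ ρ u σ * Complex.sinh (df κ ρ u σ * (t : ℂ) / 2)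

theorem csqrt_sq {z : ℂ} (hz : z ≠ 0) : csqrt z ^ 2 = z := by
  rw [csqrt, ← Complex.exp_nat_mul]
  convert Complex.exp_log hz using 2
  push_cast
  ring

theorem csqrt_ne_zero (z : ℂ) : csqrt z ≠ 0 := Complex.exp_ne_zero _

theorem HasDerivAt.csqrt {f : ℝ → ℂ} {f' : ℂ} {x : ℝ} (hf : HasDerivAt f f' x)
    (hx : f x ∈ Complex.slitPlane) :
    HasDerivAt (fun y => csqrt (f y)) (f' / (2 * _root_.csqrt (f x))) x := by
  refine ((hf.clog_real hx).const_mul (1 / 2 : ℂ)).cexp.congr_deriv ?_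
  change _root_.csqrt (f x) * _ = _
  have h0 := csqrt_ne_zero (f x)
  have hfx := Complex.slitPlane_ne_zero hx
  field_simp
  rw [csqrt_sq hfx, mul_comm]

theorem hasDerivAt_ξf (κ ρ : ℝ) (u : ℂ) (σ : ℝ) :
    HasDerivAt (ξf κ ρ u) (-(ρ * Complex.I * u)) σ := by
  have hσ : HasDerivAt (fun s : ℝ => (s : ℂ)) 1 σ := Complex.ofRealCLM.hasDerivAt
  exact ((((hσ.mul_const (ρ : ℂ)).mul_const Complex.I).mul_const u).const_sub (κ : ℂ)).congr_deriv
    (by ring)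

theorem hasDerivAt_df (κ ρ : ℝ) (u : ℂ) (σ : ℝ)
    (hw : (ξf κ ρ u σ) ^ 2 + (σ : ℂ) ^ 2 * (u ^ 2 + Complex.I * u) ∈ Complex.slitPlane) :
    HasDerivAt (df κ ρ u)
      ((-(ρ * Complex.I * u) * ξf κ ρ u σ + σ * (u ^ 2 + Complex.I * u)) / df κ ρ u σ) σ := by
  have hσ : HasDerivAt (fun s : ℝ => (s : ℂ)) 1 σ := Complex.ofRealCLM.hasDerivAt
  have hrad := ((hasDerivAt_ξf κ ρ u σ).fun_pow 2).fun_add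
    ((hσ.fun_pow 2).mul_const (u ^ 2 + Complex.I * u))
  refine (hrad.csqrt hw).congr_deriv ?_
  change _ / (2 * df κ ρ u σ) = _
  have hd : df κ ρ u σ ≠ 0 := csqrt_ne_zero _
  field_simp
  push_cast
  ring

/-- `∂A₂/∂σ = (ρ/σ)·A₂ρ' − ((2+tξ)/(iutξ))·A₁ρ' + σtA₁/2`, where `A₁ρ'`, `A₂ρ'` are the
ρ-partial derivative expressions of `A₁` and `A₂`. -/
theorem hasDerivAt_A₂_sigma (κ ρ t : ℝ) (ht : 0 < t) (u : ℂ) (hu : u ≠ 0) (σ₀ : ℝ)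
    (hσ₀ : σ₀ ≠ 0)
    (hw : (ξf κ ρ u σ₀) ^ 2 + (σ₀ : ℂ) ^ 2 * (u ^ 2 + Complex.I * u) ∈ Complex.slitPlane)
    (hξ0 : ξf κ ρ u σ₀ ≠ 0) (A₁ρ' A₂ρ' : ℂ)
    (hA₁ρ' : A₁ρ' = -(Complex.I * u * (u ^ 2 + Complex.I * u) * (t : ℂ) * ξf κ ρ u σ₀ *
      (σ₀ : ℂ)) * Complex.cosh (df κ ρ u σ₀ * (t : ℂ) / 2) / (2 * df κ ρ u σ₀))
    (hA₂ρ' : A₂ρ' = -((σ₀ : ℂ) * Complex.I * u * (2 + (t : ℂ) * ξf κ ρ u σ₀)) *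
      (ξf κ ρ u σ₀ * Complex.cosh (df κ ρ u σ₀ * (t : ℂ) / 2) +
        df κ ρ u σ₀ * Complex.sinh (df κ ρ u σ₀ * (t : ℂ) / 2)) / (2 * df κ ρ u σ₀)) :
    HasDerivAt (A₂f κ ρ t u)
      (((ρ : ℂ) / (σ₀ : ℂ)) * A₂ρ' -
        ((2 + (t : ℂ) * ξf κ ρ u σ₀) / (Complex.I * u * (t : ℂ) * ξf κ ρ u σ₀)) * A₁ρ' +
        (σ₀ : ℂ) * (t : ℂ) * A₁f κ ρ t u σ₀ / 2) σ₀ := by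
  have hd : df κ ρ u σ₀ ≠ 0 := csqrt_ne_zero _
  have htc : (t : ℂ) ≠ 0 := Complex.ofReal_ne_zero.mpr ht.ne'
  have hσc : (σ₀ : ℂ) ≠ 0 := Complex.ofReal_ne_zero.mpr hσ₀
  have hI := Complex.I_ne_zero
  have hd' := hasDerivAt_df κ ρ u σ₀ hw
  have hξ' := hasDerivAt_ξf κ ρ u σ₀
  have harg := (hd'.mul_const (t : ℂ)).div_const 2
  have hcosh := (Complex.hasDerivAt_cosh _).comp σ₀ harg
  have hsinh := (Complex.hasDerivAt_sinh _).comp σ₀ harg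
  refine ((hd'.mul hcosh).add (hξ'.mul hsinh)).congr_deriv ?_
  subst hA₁ρ' hA₂ρ'
  simp only [A₁f, Function.comp_apply]
  generalize df κ ρ u σ₀ = d at *
  generalize ξf κ ρ u σ₀ = ξ at *
  generalize Complex.cosh (d * t / 2) = c
  generalize Complex.sinh (d * t / 2) = s
  generalize Complex.I = j at *
  field_simp
  ring
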